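/- Let T be an order in L with σ(T) = T, let 𝒯 and 𝒯' both be transversals of Tˣ modulo H, let i₀ ∈ L be nonzero, let w ∈ Tˣ, let b ∈ L be nonzero totally imaginary, and let α ∈ L be nonzero totally real. Then the set {i₀·u : u ∈ 𝒯 such that α⁻¹·i₀·u is totally imaginary and Φ_b-positive} is in bijection with the set {(w·i₀)·u : u ∈ 𝒯' such that α⁻¹·(w·i₀)·u is totally imaginary and Φ_b-positive}; that is, the set P_α(Φ_b) is, up to bijection, independent of the choice of the transversal 𝒯 and of replacing i₀ by w·i₀ with w ∈ Tˣ. -/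

import Mathlib

variable {L : Type*} [Field L] [NumberField L]

/-- `x ∈ L` is totally real w.r.t. the CM involution `σ`. -/
def TotallyReal (σ : L ≃ₐ[ℚ] L) (x : L) : Prop := σ x = x

/-- `x ∈ L` is totally imaginary w.r.t. the CM involution `σ`. -/
def TotallyImaginary (σ : L ≃ₐ[ℚ] L) (x : L) : Prop := σ x = -x

/-- `x ∈ L` is totally positive: totally real and every complex embedding sends it to a
positive real number. -/
def TotallyPositive (σ : L ≃ₐ[ℚ] L) (x : L) : Prop :=
  σ x = x ∧ ∀ φ : L →+* ℂ, (φ x).im = 0 ∧ 0 < (φ x).re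

/-- The CM-type `Φ_b` attached to a (nonzero totally imaginary) element `b ∈ L`:
the set of complex embeddings `φ` with `Im (φ b) > 0`. -/
def CMType (b : L) : Set (L →+* ℂ) := {φ | 0 < (φ b).im}

/-- `x ∈ L` is `Φ_b`-positive: `Im (φ x) > 0` for every `φ ∈ Φ_b`. -/
def PhiPositive (b x : L) : Prop := ∀ φ ∈ CMType b, 0 < (φ x).im

/-- A unit of an order (subring) `T` of `L`: an element of `T` with an inverse in `T`. -/
def IsUnitOfOrder (T : Subring L) (u : L) : Prop := u ∈ T ∧ ∃ v ∈ T, u * v = 1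

/-- An order in `L`: a subring which is finitely generated as a `ℤ`-module and contains a
`ℚ`-basis of `L` (i.e. spans `L` over `ℚ`). -/
def IsOrder (T : Subring L) : Prop :=
  (Submodule.span ℤ (T : Set L)).FG ∧ Submodule.span ℚ (T : Set L) = ⊤

/-- `𝒯` is a transversal of `Tˣ` modulo the subgroup `H` generated by
`{v·σ(v) : v ∈ Tˣ}` (when `σ(T) = T` this generating set is itself a subgroup, since it is
closed under products and inverses, so `H = {v·σ(v) : v ∈ Tˣ}`): every unit of `T` is
congruent modulo `H` to exactly one element of `𝒯`. -/
def IsTransversal (σ : L ≃ₐ[ℚ] L) (T : Subring L) (𝒯 : Set L) : Prop :=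
  (∀ u ∈ 𝒯, IsUnitOfOrder T u) ∧
  ∀ u : L, IsUnitOfOrder T u →
    ∃! t : L, t ∈ 𝒯 ∧ ∃ v : L, IsUnitOfOrder T v ∧ u = t * (v * σ v)

/-- The set `P_α(Φ_b) = {i₀·u : u ∈ 𝒯 such that α⁻¹·i₀·u is totally imaginary and
Φ_b-positive}`; the set `P_1(Φ_b)` is the special case `α = 1`. -/
def Pset (σ : L ≃ₐ[ℚ] L) (𝒯 : Set L) (i₀ α b : L) : Set L :=
  {x | ∃ u ∈ 𝒯, x = i₀ * u ∧ TotallyImaginary σ (α⁻¹ * (i₀ * u)) ∧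
    PhiPositive b (α⁻¹ * (i₀ * u))}

theorem IsUnitOfOrder.mul {T : Subring L} {u v : L} (hu : IsUnitOfOrder T u)
    (hv : IsUnitOfOrder T v) : IsUnitOfOrder T (u * v) := by
  obtain ⟨hu, u', hu', huu'⟩ := hu
  obtain ⟨hv, v', hv', hvv'⟩ := hv
  exact ⟨T.mul_mem hu hv, u' * v', T.mul_mem hu' hv', by rw [mul_mul_mul_comm, huu', hvv', one_mul]⟩

theorem IsUnitOfOrder.ne_zero {T : Subring L} {u : L} (hu : IsUnitOfOrder T u) : u ≠ 0 := by
  obtain ⟨-, v, -, h⟩ := hu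
  exact left_ne_zero_of_mul_eq_one h

theorem IsUnitOfOrder.inv {T : Subring L} {u : L} (hu : IsUnitOfOrder T u) :
    IsUnitOfOrder T u⁻¹ := by
  have h0 := hu.ne_zero
  obtain ⟨hu, v, hv, h⟩ := hu
  rw [← eq_inv_of_mul_eq_one_right h]
  exact ⟨hv, u, hu, by rw [mul_comm, h]⟩

/-- The norm `v * σ v` of a nonzero element is totally positive. -/
theorem totallyPositive_mul_conj {σ : L ≃ₐ[ℚ] L}
    (hσ : ∀ (φ : L →+* ℂ) (x : L), φ (σ x) = (starRingEnd ℂ) (φ x)) {v : L} (hv : v ≠ 0) :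
    TotallyPositive σ (v * σ v) := by
  have h (φ : L →+* ℂ) : φ (v * σ v) = (Complex.normSq (φ v) : ℂ) := by
    rw [map_mul, hσ, Complex.mul_conj]
  refine ⟨?_, fun φ ↦ ?_⟩
  · obtain ⟨φ⟩ : Nonempty (L →+* ℂ) := inferInstance
    apply φ.injective
    rw [hσ, h, Complex.conj_ofReal]
  · rw [h, Complex.ofReal_im, Complex.ofReal_re, Complex.normSq_pos]
    exact ⟨rfl, (map_ne_zero φ).2 hv⟩

theorem TotallyImaginary.of_mul_totallyPositive {σ : L ≃ₐ[ℚ] L} {x p : L}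
    (h : TotallyImaginary σ (x * p)) (hp : TotallyPositive σ p) (hp0 : p ≠ 0) :
    TotallyImaginary σ x := by
  unfold TotallyImaginary at *
  rw [map_mul, hp.1, ← neg_mul] at h
  exact mul_right_cancel₀ hp0 h

theorem PhiPositive.of_mul_totallyPositive {σ : L ≃ₐ[ℚ] L} {b x p : L}
    (h : PhiPositive b (x * p)) (hp : TotallyPositive σ p) : PhiPositive b x := by
  intro φ hφ
  have hx := h φ hφ
  obtain ⟨him, hre⟩ := hp.2 φ
  rw [map_mul, Complex.mul_im, him, mul_zero, zero_add] at hx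
  exact pos_of_mul_pos_left hx hre.le

/-- Every totally imaginary `Φ_b`-positive multiple of `i₀` by a unit has, up to norms of units,
a unique representative in `Pset`. -/
theorem IsTransversal.existsUnique_mem_Pset {σ : L ≃ₐ[ℚ] L}
    (hσ : ∀ (φ : L →+* ℂ) (x : L), φ (σ x) = (starRingEnd ℂ) (φ x))
    {T : Subring L} {𝒯 : Set L} (h𝒯 : IsTransversal σ T 𝒯) {i₀ α b u : L} (hi₀ : i₀ ≠ 0)
    (hu : IsUnitOfOrder T u) (him : TotallyImaginary σ (α⁻¹ * (i₀ * u)))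
    (hpos : PhiPositive b (α⁻¹ * (i₀ * u))) :
    ∃! y : Pset σ 𝒯 i₀ α b, ∃ v, IsUnitOfOrder T v ∧ i₀ * u = y * (v * σ v) := by
  obtain ⟨t, ⟨ht, v, hv, rfl⟩, huniq⟩ := h𝒯.2 u hu
  have hp := totallyPositive_mul_conj hσ hv.ne_zero
  have hp0 : v * σ v ≠ 0 := mul_ne_zero hv.ne_zero ((map_ne_zero σ).2 hv.ne_zero)
  rw [← mul_assoc i₀, ← mul_assoc α⁻¹] at him hpos
  refine ⟨⟨i₀ * t, t, ht, rfl, him.of_mul_totallyPositive hp hp0,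
    hpos.of_mul_totallyPositive hp⟩, ⟨v, hv, (mul_assoc _ _ _).symm⟩, ?_⟩
  rintro ⟨_, s, hs, rfl, _⟩ ⟨v', hv', h⟩
  simp only [mul_assoc i₀] at h
  exact Subtype.ext (congrArg (i₀ * ·) (huniq s ⟨hs, v', hv', mul_left_cancel₀ hi₀ h⟩))

theorem nonempty_equiv_of_existsUnique {X Y : Type*} (R : X → Y → Prop)
    (hX : ∀ x, ∃! y, R x y) (hY : ∀ y, ∃! x, R x y) : Nonempty (X ≃ Y) := by
  choose f hf hf' using hX
  refine ⟨Equiv.ofBijective f ⟨fun x₁ x₂ h ↦ ?_, fun y ↦ ?_⟩⟩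
  · exact (hY (f x₁)).unique (hf x₁) (h ▸ hf x₂)
  · obtain ⟨x, hx, -⟩ := hY y
    exact ⟨x, (hf' x y hx).symm⟩

/-- Congruence modulo norms of units is symmetric. -/
theorem exists_eq_mul_norm_comm {σ : L ≃ₐ[ℚ] L} {T : Subring L} {x y : L} :
    (∃ v, IsUnitOfOrder T v ∧ x = y * (v * σ v)) ↔
      ∃ v, IsUnitOfOrder T v ∧ y = x * (v * σ v) := by
  suffices h : ∀ {x y : L}, (∃ v, IsUnitOfOrder T v ∧ x = y * (v * σ v)) →
      ∃ v, IsUnitOfOrder T v ∧ y = x * (v * σ v) from ⟨h, h⟩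
  rintro _ y ⟨v, hv, rfl⟩
  have hv0 := hv.ne_zero
  have hσv0 : σ v ≠ 0 := (map_ne_zero σ).2 hv0
  refine ⟨v⁻¹, hv.inv, ?_⟩
  rw [map_inv₀]
  field_simp

/-- With `T` an order in `L` stable under `σ`, `𝒯` and `𝒯'` two
transversals of `Tˣ` modulo `H`, `i₀ ∈ L` nonzero, `w` a unit of `T`, `b ∈ L` nonzero
totally imaginary, and `α ∈ L` nonzero totally real: the set
`{i₀·u : u ∈ 𝒯, α⁻¹·i₀·u totally imaginary and Φ_b-positive}` is in bijection with
`{(w·i₀)·u : u ∈ 𝒯', α⁻¹·(w·i₀)·u totally imaginary and Φ_b-positive}`; i.e. `P_α(Φ_b)`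
is, up to bijection, independent of the transversal and of replacing `i₀` by `w·i₀`. -/
theorem Pset_equiv_of_transversals (σ : L ≃ₐ[ℚ] L)
    (hσ : ∀ (φ : L →+* ℂ) (x : L), φ (σ x) = (starRingEnd ℂ) (φ x))
    (T : Subring L) (hT : IsOrder T) (hTσ : ∀ x : L, σ x ∈ T ↔ x ∈ T)
    (𝒯 𝒯' : Set L) (h𝒯 : IsTransversal σ T 𝒯) (h𝒯' : IsTransversal σ T 𝒯')
    (i₀ : L) (hi₀ : i₀ ≠ 0)
    (w : L) (hw : IsUnitOfOrder T w)
    (b : L) (hb0 : b ≠ 0) (hb : TotallyImaginary σ b)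
    (α : L) (hα0 : α ≠ 0) (hα : TotallyReal σ α) :
    Nonempty (Pset σ 𝒯 i₀ α b ≃ Pset σ 𝒯' (w * i₀) α b) := by
  refine nonempty_equiv_of_existsUnique
    (fun x y ↦ ∃ v, IsUnitOfOrder T v ∧ (x : L) = y * (v * σ v)) ?_ ?_
  · rintro ⟨_, u, hu, rfl, him, hpos⟩
    have h : i₀ * u = w * i₀ * (w⁻¹ * u) := by
      have := hw.ne_zero
      field_simp
    rw [h] at him hpos
    simp only [h]
    exact h𝒯'.existsUnique_mem_Pset hσ (mul_ne_zero hw.ne_zero hi₀)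
      (hw.inv.mul (h𝒯.1 u hu)) him hpos
  · rintro ⟨_, u, hu, rfl, him, hpos⟩
    have h : w * i₀ * u = i₀ * (w * u) := by ring
    rw [h] at him hpos
    simp only [h, exists_eq_mul_norm_comm (y := i₀ * (w * u))]
    exact h𝒯.existsUnique_mem_Pset hσ hi₀ (hw.mul (h𝒯'.1 u hu)) him hpos
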